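/- arXiv:1903.02840 — 4 statements merged into one kernel-verified Lean document; each statement's English description precedes it below -/
import Mathlib

section
/- Let Ω be a finite probability space, X a nonempty finite set with |X| = N, and S a finite set. Let Z : Ω → (X → {0,1}) be a random variable whose law is the uniform distribution on the set of all functions from X to {0,1}, and let W : Ω → S be any random variable. Suppose there is a prediction function g : S → (X → {0,1}) and a real ε ∈ [0, 1/2] such that the average error satisfies (1/N) · Σ_{x ∈ X} Pr[g(W)(x) ≠ Z(x)] ≤ 1/2 − ε. Then the mutual information between Z and W (in nats) satisfies I(Z : W) ≥ 2Nε². -/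
open Finset

open scoped Classical

/-- Probability of an event `E` under the weight function `μ` on a finite sample space. -/
noncomputable def prob {Ω : Type*} [Fintype Ω] (μ : Ω → ℝ) (E : Ω → Prop) : ℝ :=
  ∑ ω, if E ω then μ ω else 0

/-- Shannon entropy (in nats) of a finitely-valued random variable `V`. -/
noncomputable def entropy {Ω α : Type*} [Fintype Ω] [Fintype α]
    (μ : Ω → ℝ) (V : Ω → α) : ℝ :=
  -∑ a, prob μ (fun ω => V ω = a) * Real.log (prob μ (fun ω => V ω = a))

/-- Conditional Shannon entropy (in nats) `H(V | W) = ∑_b P[W = b] · H(V | W = b)`. -/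
noncomputable def condEntropy {Ω α β : Type*} [Fintype Ω] [Fintype α] [Fintype β]
    (μ : Ω → ℝ) (V : Ω → α) (W : Ω → β) : ℝ :=
  ∑ b, prob μ (fun ω => W ω = b) *
    (-∑ a, (prob μ (fun ω => V ω = a ∧ W ω = b) / prob μ (fun ω => W ω = b)) *
        Real.log (prob μ (fun ω => V ω = a ∧ W ω = b) / prob μ (fun ω => W ω = b)))

/-- Mutual information (in nats) `I(V : W) = H(V) − H(V | W)`. -/
noncomputable def mutualInfo {Ω α β : Type*} [Fintype Ω] [Fintype α] [Fintype β]
    (μ : Ω → ℝ) (V : Ω → α) (W : Ω → β) : ℝ :=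
  entropy μ V - condEntropy μ V W

theorem prob_nonneg {Ω : Type*} [Fintype Ω] {μ : Ω → ℝ} (hμ : ∀ ω, 0 ≤ μ ω) (E : Ω → Prop) :
    0 ≤ prob μ E :=
  Finset.sum_nonneg fun ω _ => by split_ifs <;> simp [hμ ω]

theorem sum_prob_and_eq {Ω α : Type*} [Fintype Ω] [Fintype α] (μ : Ω → ℝ) (V : Ω → α)
    (E : Ω → Prop) : ∑ a, prob μ (fun ω => V ω = a ∧ E ω) = prob μ E := by
  unfold prob
  rw [Finset.sum_comm]
  refine Finset.sum_congr rfl fun ω _ => ?_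
  by_cases h : E ω <;> simp [h]

theorem sum_prob_mul {Ω α β : Type*} [Fintype Ω] [Fintype α] [Fintype β] (μ : Ω → ℝ)
    (V : Ω → α) (W : Ω → β) (F : α → β → ℝ) :
    ∑ b, ∑ a, prob μ (fun ω => V ω = a ∧ W ω = b) * F a b = ∑ ω, μ ω * F (V ω) (W ω) := by
  have h : ∀ b a, prob μ (fun ω => V ω = a ∧ W ω = b) * F a b
      = ∑ ω, if V ω = a then (if W ω = b then μ ω * F a b else 0) else 0 := fun b a => by
    rw [prob, Finset.sum_mul]
    refine Finset.sum_congr rfl fun ω _ => ?_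
    by_cases h1 : V ω = a <;> by_cases h2 : W ω = b <;> simp [h1, h2]
  simp_rw [h]
  calc _ = ∑ b, ∑ ω, if W ω = b then μ ω * F (V ω) b else 0 := by
        refine Finset.sum_congr rfl fun b _ => ?_
        rw [Finset.sum_comm]
        simp
    _ = _ := by
        rw [Finset.sum_comm]
        simp

theorem sub_le_mul_log_div_add {p m L : ℝ} (hp : 0 ≤ p) (hm : 0 < m) :
    p - m * Real.exp (-L) ≤ p * Real.log (p / m) + p * L := by
  have hc : 0 < m * Real.exp (-L) := by positivity
  rcases hp.eq_or_lt with rfl | hp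
  · simpa using hc.le
  · have h := Real.add_one_le_exp (-(Real.log (p / m) + L))
    have h2 : Real.exp (-(Real.log (p / m) + L)) = m * Real.exp (-L) / p := by
      rw [neg_add, Real.exp_add, ← Real.log_inv, Real.exp_log (by positivity), inv_div]
      ring
    rw [h2, le_div_iff₀ hp] at h
    nlinarith

/-- Gibbs' inequality: the conditional entropy is at most the expected code length, for every
code length `L` satisfying Kraft's inequality. -/
theorem condEntropy_le_of_sum_exp_le_one {Ω α β : Type*} [Fintype Ω] [Fintype α] [Fintype β]
    {μ : Ω → ℝ} (hμ : ∀ ω, 0 ≤ μ ω) (V : Ω → α) (W : Ω → β) (L : α → β → ℝ)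
    (hL : ∀ b, ∑ a, Real.exp (-L a b) ≤ 1) :
    condEntropy μ V W ≤ ∑ ω, μ ω * L (V ω) (W ω) := by
  rw [← sum_prob_mul, condEntropy]
  refine Finset.sum_le_sum fun b _ => ?_
  have hsum := sum_prob_and_eq μ V (fun ω => W ω = b)
  set m := prob μ (fun ω => W ω = b)
  have hp : ∀ a, 0 ≤ prob μ (fun ω => V ω = a ∧ W ω = b) := fun a => prob_nonneg hμ _
  rcases (prob_nonneg hμ _ : 0 ≤ m).eq_or_lt with hm | hm
  · have h0 : ∀ a, prob μ (fun ω => V ω = a ∧ W ω = b) = 0 := fun a =>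
      (Finset.sum_eq_zero_iff_of_nonneg fun a _ => hp a).1 (hsum.trans hm.symm) a (mem_univ a)
    simp [h0]
  · have h := Finset.sum_le_sum fun a (_ : a ∈ univ) =>
      sub_le_mul_log_div_add (L := L a b) (hp a) hm
    rw [Finset.sum_sub_distrib, ← Finset.mul_sum, hsum, Finset.sum_add_distrib] at h
    have h1 := mul_le_mul_of_nonneg_left (hL b) hm.le
    rw [mul_neg, Finset.mul_sum]
    have h2 : ∀ a, m * (prob μ (fun ω => V ω = a ∧ W ω = b) / m *
        Real.log (prob μ (fun ω => V ω = a ∧ W ω = b) / m))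
        = prob μ (fun ω => V ω = a ∧ W ω = b) *
        Real.log (prob μ (fun ω => V ω = a ∧ W ω = b) / m) := fun a => by
      rw [← mul_assoc, mul_div_cancel₀ _ hm.ne']
    simp_rw [h2]
    linarith

theorem sum_exp_agreement {X : Type*} [Fintype X] (t : ℝ) (g : X → Bool) :
    ∑ f : X → Bool, Real.exp (t * ∑ x, if g x ≠ f x then (-1 : ℝ) else 1)
      = (2 * Real.cosh t) ^ Fintype.card X := by
  have h : ∀ x, ∑ c : Bool, Real.exp (t * if g x ≠ c then (-1 : ℝ) else 1) = 2 * Real.cosh t :=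
    fun x => by
      rw [Real.cosh_eq]
      cases g x <;> simp <;> ring
  simp_rw [Finset.mul_sum, Real.exp_sum]
  rw [← Fintype.prod_sum (fun x c => Real.exp (t * if g x ≠ c then (-1 : ℝ) else 1))]
  simp_rw [h]
  simp

theorem entropy_of_uniform {Ω X : Type*} [Fintype Ω] [Fintype X] (μ : Ω → ℝ) (Z : Ω → X → Bool)
    (hZ : ∀ f : X → Bool, prob μ (fun ω => Z ω = f) = 1 / 2 ^ Fintype.card X) :
    entropy μ Z = Fintype.card X * Real.log 2 := by
  simp [entropy, hZ]

theorem stmt_0 {Ω X S : Type*} [Fintype Ω] [Fintype X] [Nonempty X] [Fintype S]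
    (μ : Ω → ℝ) (hμ0 : ∀ ω, 0 ≤ μ ω) (hμ1 : ∑ ω, μ ω = 1)
    (N : ℕ) (hN : Fintype.card X = N)
    (Z : Ω → X → Bool) (W : Ω → S)
    (hZ : ∀ f : X → Bool, prob μ (fun ω => Z ω = f) = 1 / 2 ^ N)
    (g : S → X → Bool) (ε : ℝ) (hε0 : 0 ≤ ε) (hε1 : ε ≤ 1 / 2)
    (herr : (1 / (N : ℝ)) * ∑ x : X, prob μ (fun ω => g (W ω) x ≠ Z ω x) ≤ 1 / 2 - ε) :
    2 * N * ε ^ 2 ≤ mutualInfo μ Z W := by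
  subst hN
  have hNpos : (0 : ℝ) < Fintype.card X := by exact_mod_cast Fintype.card_pos
  set n : ℝ := (Fintype.card X : ℝ) with hn
  set A : (X → Bool) → S → ℝ := fun f s => ∑ x, if g s x ≠ f x then (-1 : ℝ) else 1 with hA
  set c : ℝ := n * (Real.log 2 + (2 * ε) ^ 2 / 2) with hc
  have hkraft : ∀ s, ∑ f, Real.exp (-(c - 2 * ε * A f s)) ≤ 1 := fun s => by
    have hcosh : 2 * Real.cosh (2 * ε) ≤ Real.exp (Real.log 2 + (2 * ε) ^ 2 / 2) := by
      rw [Real.exp_add, Real.exp_log two_pos]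
      linarith [Real.cosh_le_exp_half_sq (2 * ε)]
    have hpow : (2 * Real.cosh (2 * ε)) ^ Fintype.card X ≤ Real.exp c := by
      rw [hc, hn, Real.exp_nat_mul]
      exact pow_le_pow_left₀ (by positivity) hcosh _
    simp_rw [neg_sub, Real.exp_sub]
    rw [← Finset.sum_div, div_le_one (Real.exp_pos c), hA, sum_exp_agreement]
    exact hpow
  have hcond := condEntropy_le_of_sum_exp_le_one hμ0 Z W (fun f s => c - 2 * ε * A f s) hkraft
  have hexp : ∑ ω, μ ω * A (Z ω) (W ω)
      = n - 2 * ∑ x : X, prob μ (fun ω => g (W ω) x ≠ Z ω x) := by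
    have h : ∀ ω, μ ω * A (Z ω) (W ω)
        = n * μ ω - 2 * ∑ x, if g (W ω) x ≠ Z ω x then μ ω else 0 := fun ω => by
      have hx : ∀ x, (μ ω * if g (W ω) x ≠ Z ω x then (-1 : ℝ) else 1)
          = μ ω - 2 * if g (W ω) x ≠ Z ω x then μ ω else 0 := fun x => by
        split_ifs <;> ring
      rw [hA, Finset.mul_sum]
      simp_rw [hx]
      rw [Finset.sum_sub_distrib, ← Finset.mul_sum]
      simp [hn]
    simp_rw [h]
    rw [Finset.sum_sub_distrib, ← Finset.mul_sum, ← Finset.mul_sum, hμ1, Finset.sum_comm, mul_one]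
    unfold prob
    congr! 5
  have hsplit : ∑ ω, μ ω * (c - 2 * ε * A (Z ω) (W ω))
      = c - 2 * ε * ∑ ω, μ ω * A (Z ω) (W ω) := by
    simp_rw [mul_sub]
    rw [Finset.sum_sub_distrib, ← Finset.sum_mul, hμ1, one_mul, Finset.mul_sum]
    exact congrArg _ (Finset.sum_congr rfl fun ω _ => by ring)
  rw [hsplit, hexp] at hcond
  rw [one_div, inv_mul_le_iff₀ hNpos] at herr
  have hgain := mul_le_mul_of_nonneg_left herr hε0
  rw [mutualInfo, entropy_of_uniform μ Z hZ]
  nlinarith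
end

section
/- For every real ε with 0 ≤ ε ≤ 1/4, the binary entropy satisfies ln 2 − H_b(1/2 + ε) ≤ 2ε² + 2ε⁴. -/
open Finset

/-- The binary entropy function (in nats), with the convention `H_b 0 = H_b 1 = 0`. -/
noncomputable def binEntropy (p : ℝ) : ℝ :=
  -(p * Real.log p) - (1 - p) * Real.log (1 - p)

/-- Comparison of two functions on `[0, b]` through their derivatives. -/
lemma le_of_hasDerivAt_le {f f' g g' : ℝ → ℝ} {b : ℝ} (h0 : f 0 ≤ g 0)
    (hf : ∀ x ∈ Set.Icc 0 b, HasDerivAt f (f' x) x)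
    (hg : ∀ x ∈ Set.Icc 0 b, HasDerivAt g (g' x) x)
    (hfg : ∀ x ∈ Set.Icc 0 b, f' x ≤ g' x) : ∀ x ∈ Set.Icc 0 b, f x ≤ g x :=
  image_le_of_deriv_right_le_deriv_boundary
    (fun x hx => (hf x hx).continuousAt.continuousWithinAt)
    (fun x hx => (hf x (Set.Ico_subset_Icc_self hx)).hasDerivWithinAt) h0
    (fun x hx => (hg x hx).continuousAt.continuousWithinAt)
    (fun x hx => (hg x (Set.Ico_subset_Icc_self hx)).hasDerivWithinAt)
    (fun x hx => hfg x (Set.Ico_subset_Icc_self hx))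

lemma hasDerivAt_log_half_add_sub_log_half_sub {t : ℝ} (h0 : -(1 / 2) < t) (h1 : t < 1 / 2) :
    HasDerivAt (fun t : ℝ => Real.log (1 / 2 + t) - Real.log (1 / 2 - t))
      (1 / (1 / 4 - t ^ 2)) t := by
  have ha : 1 / 2 + t ≠ 0 := by linarith
  have hb : 1 / 2 - t ≠ 0 := by linarith
  have hc : 1 / 4 - t ^ 2 ≠ 0 := by
    rw [show 1 / 4 - t ^ 2 = (1 / 2 + t) * (1 / 2 - t) by ring]
    exact mul_ne_zero ha hb
  have h := (((hasDerivAt_id t).const_add (1 / 2)).log ha).sub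
    (((hasDerivAt_id t).const_sub (1 / 2)).log hb)
  refine h.congr_deriv ?_
  simp only [id_eq]
  rw [show 1 / 4 - t ^ 2 = (1 / 2 + t) * (1 / 2 - t) by ring, div_sub_div _ _ ha hb]
  ring

lemma hasDerivAt_log_two_sub_binEntropy {t : ℝ} (h0 : -(1 / 2) < t) (h1 : t < 1 / 2) :
    HasDerivAt (fun t : ℝ => Real.log 2 - binEntropy (1 / 2 + t))
      (Real.log (1 / 2 + t) - Real.log (1 / 2 - t)) t := by
  have h := (Real.hasDerivAt_binEntropy (p := 1 / 2 + t) (by linarith) (by linarith)).comp_const_add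
    (1 / 2) t
  have heq : binEntropy = Real.binEntropy := by
    ext p
    simp only [binEntropy, Real.binEntropy, Real.log_inv]
    ring
  rw [heq]
  refine (h.const_sub (Real.log 2)).congr_deriv ?_
  rw [show 1 - (1 / 2 + t) = 1 / 2 - t by ring]
  ring

lemma log_half_add_sub_log_half_sub_le :
    ∀ t ∈ Set.Icc (0 : ℝ) (1 / 4),
      Real.log (1 / 2 + t) - Real.log (1 / 2 - t) ≤ 4 * t + 8 * t ^ 3 := by
  refine le_of_hasDerivAt_le (g' := fun t => 4 + 24 * t ^ 2) (by simp)
    (fun t ht => hasDerivAt_log_half_add_sub_log_half_sub (by linarith [ht.1]) (by linarith [ht.2]))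
    (fun t _ => ?_) (fun t ht => ?_)
  · refine (((hasDerivAt_id t).const_mul 4).add ((hasDerivAt_pow 3 t).const_mul 8)).congr_deriv ?_
    norm_num
    ring
  · have hsq : t ^ 2 ≤ 1 / 16 := by nlinarith [ht.1, ht.2]
    rw [div_le_iff₀ (by linarith)]
    nlinarith [mul_nonneg (sq_nonneg t) (sub_nonneg.2 hsq), sq_nonneg t]

theorem stmt_7 (ε : ℝ) (hε0 : 0 ≤ ε) (hε1 : ε ≤ 1 / 4) :
    Real.log 2 - binEntropy (1 / 2 + ε) ≤ 2 * ε ^ 2 + 2 * ε ^ 4 := by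
  refine le_of_hasDerivAt_le (f := fun t => Real.log 2 - binEntropy (1 / 2 + t))
    (g := fun t => 2 * t ^ 2 + 2 * t ^ 4) ?_
    (fun t ht => hasDerivAt_log_two_sub_binEntropy (by linarith [ht.1]) (by linarith [ht.2]))
    (fun t _ => ?_) log_half_add_sub_log_half_sub_le ε ⟨hε0, hε1⟩
  · have hlog : Real.log (1 / 2) = -Real.log 2 := by rw [one_div, Real.log_inv]
    norm_num [binEntropy]
    linarith
  · refine (((hasDerivAt_pow 2 t).const_mul 2).add
      ((hasDerivAt_pow 4 t).const_mul 2)).congr_deriv ?_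
    norm_num
    ring
end

section
/- Let ι be a finite type, let S be a finite subset of ι with |S| = L ≥ 2, and let e* ∈ S. In the real Euclidean space ℝ^ι with the standard orthonormal basis (δ_s)_{s ∈ ι}, define the unit vectors ψ = (1/√L) · Σ_{s ∈ S} δ_s and φ = (1/√(L−1)) · Σ_{s ∈ S \ {e*}} δ_s. For an integer t ≥ 1, define the t-fold product vectors Ψ, Φ ∈ ℝ^{(Fin t → ι)} by Ψ(f) = Π_{i=1}^t ψ(f(i)) and Φ(f) = Π_{i=1}^t φ(f(i)). Then ‖Ψ − Φ‖² ≤ 2t/L. -/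
open Finset

/-- The inner product of `t`-fold tensor powers is the `t`-th power of the inner product. -/
theorem inner_tensorPower {ι : Type*} [Fintype ι] {t : ℕ} {x y : EuclideanSpace ℝ ι}
    {X Y : EuclideanSpace ℝ (Fin t → ι)}
    (hX : ∀ f : Fin t → ι, X f = ∏ i, x (f i)) (hY : ∀ f : Fin t → ι, Y f = ∏ i, y (f i)) :
    inner ℝ X Y = inner ℝ x y ^ t := by
  classical
  simp only [PiLp.inner_apply, hX, hY, RCLike.inner_apply, conj_trivial, ← Finset.prod_mul_distrib]
  rw [Fintype.sum_pow]

theorem inner_sum_single_sum_single {ι : Type*} [Fintype ι] [DecidableEq ι] (A B : Finset ι) :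
    inner ℝ (∑ s ∈ A, EuclideanSpace.single s (1 : ℝ)) (∑ s ∈ B, EuclideanSpace.single s (1 : ℝ)) =
      ((A ∩ B).card : ℝ) := by
  simp [sum_inner, inner_sum, EuclideanSpace.inner_single_left, sum_ite_mem, inter_comm]

theorem stmt_9 {ι : Type*} [Fintype ι] [DecidableEq ι]
    (S : Finset ι) (L : ℕ) (hL : 2 ≤ L) (hS : S.card = L) (e : ι) (he : e ∈ S)
    (ψ φ : EuclideanSpace ℝ ι)
    (hψ : ψ = (1 / Real.sqrt L) • ∑ s ∈ S, EuclideanSpace.single s (1 : ℝ))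
    (hφ : φ = (1 / Real.sqrt ((L : ℝ) - 1)) • ∑ s ∈ S.erase e, EuclideanSpace.single s (1 : ℝ))
    (t : ℕ) (ht : 1 ≤ t)
    (Ψ Φ : EuclideanSpace ℝ (Fin t → ι))
    (hΨ : ∀ f : Fin t → ι, Ψ f = ∏ i, ψ (f i))
    (hΦ : ∀ f : Fin t → ι, Φ f = ∏ i, φ (f i)) :
    ‖Ψ - Φ‖ ^ 2 ≤ 2 * t / L := by
  have hL' : (2 : ℝ) ≤ L := by exact_mod_cast hL
  have hcard : ((S.erase e).card : ℝ) = L - 1 := by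
    rw [card_erase_of_mem he, hS, Nat.cast_pred (by omega)]
  set a := Real.sqrt L with ha
  set b := Real.sqrt ((L : ℝ) - 1) with hb
  have ha2 : a ^ 2 = L := Real.sq_sqrt (by linarith)
  have hb2 : b ^ 2 = L - 1 := Real.sq_sqrt (by linarith)
  have ha0 : 0 < a := Real.sqrt_pos.2 (by linarith)
  have hb0 : 0 < b := Real.sqrt_pos.2 (by linarith)
  have hψψ : inner ℝ ψ ψ = 1 := by
    rw [hψ, real_inner_smul_left, real_inner_smul_right, inner_sum_single_sum_single, inter_self,
      hS, ← ha2]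
    field_simp
  have hφφ : inner ℝ φ φ = 1 := by
    rw [hφ, real_inner_smul_left, real_inner_smul_right, inner_sum_single_sum_single, inter_self,
      hcard, ← hb2]
    field_simp
  have hψφ : inner ℝ ψ φ = b / a := by
    rw [hψ, hφ, real_inner_smul_left, real_inner_smul_right, inner_sum_single_sum_single,
      inter_eq_right.2 (erase_subset e S), hcard, ← hb2]
    field_simp
  have hba : b ≤ a := Real.sqrt_le_sqrt (by linarith)
  have hoverlap : 1 - 1 / (L : ℝ) ≤ b / a :=
    calc 1 - 1 / (L : ℝ) = (b / a) ^ 2 := by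
          rw [div_pow, ha2, hb2]; field_simp
      _ ≤ b / a := pow_le_of_le_one (by positivity) ((div_le_one ha0).2 hba) two_ne_zero
  have hinv : 1 / (L : ℝ) ≤ 1 := (div_le_one (by linarith)).2 (by linarith)
  have hpow : 1 - t / (L : ℝ) ≤ (b / a) ^ t :=
    calc 1 - t / (L : ℝ) = 1 + t * (-(1 / (L : ℝ))) := by ring
      _ ≤ (1 + -(1 / (L : ℝ))) ^ t := one_add_mul_le_pow (by linarith) t
      _ ≤ (b / a) ^ t := pow_le_pow_left₀ (by linarith) (by linarith) t
  rw [norm_sub_sq_real, ← real_inner_self_eq_norm_sq, ← real_inner_self_eq_norm_sq,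
    inner_tensorPower hΨ hΨ, inner_tensorPower hΦ hΦ, inner_tensorPower hΨ hΦ, hψψ, hφφ, hψφ,
    one_pow, mul_div_assoc]
  linarith
end

section
/- Let c, η, ε be reals with c > η > 1 and 0 < ε ≤ η/(η+c). For a real d' > 2, set d = (log₂ d')^c, k = d^{1/η}, and λ = (k²/(k+1)) · log₂ d (so that λ = log₂ q for the modulus q of the PRF). Then there exist a constant C > 0 and a threshold N such that for all reals d' ≥ N, one has λ^ε ≤ C · log₂ d'. -/
theorem stmt_16 (c η ε : ℝ) (hη : 1 < η) (hc : η < c) (hε0 : 0 < ε)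
    (hε : ε ≤ η / (η + c)) :
    ∃ C : ℝ, 0 < C ∧ ∃ N : ℝ, ∀ d' : ℝ, N ≤ d' → 2 < d' →
      ∀ d k lam : ℝ, d = (Real.logb 2 d') ^ c → k = d ^ (1 / η) →
        lam = (k ^ 2 / (k + 1)) * Real.logb 2 d →
        lam ^ ε ≤ C * Real.logb 2 d' := by
  have hη0 : 0 < η := by linarith
  have hc0 : 0 < c := by linarith
  have hlog2 : 0 < Real.log 2 := Real.log_pos one_lt_two
  have hK : 0 < c / Real.log 2 := by positivity
  refine ⟨(c / Real.log 2) ^ ε, by positivity, 0, ?_⟩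
  rintro d' - hd' d k lam rfl rfl rfl
  have hL : 1 < Real.logb 2 d' := by
    rw [Real.lt_logb_iff_rpow_lt one_lt_two (by linarith)]
    simpa using hd'
  generalize Real.logb 2 d' = L at hL ⊢
  have hL0 : 0 < L := by linarith
  have hk : (L ^ c) ^ (1 / η) = L ^ (c / η) := by
    rw [← Real.rpow_mul hL0.le, mul_one_div]
  rw [hk, Real.logb_rpow_eq_mul_logb_of_pos hL0]
  have hk0 : 0 < L ^ (c / η) := by positivity
  have hlogb0 : 0 ≤ Real.logb 2 L := Real.logb_nonneg one_lt_two hL.le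
  have hlogb : Real.logb 2 L ≤ L / Real.log 2 := by
    rw [Real.logb]
    gcongr
    exact Real.log_le_self hL0.le
  have hfrac : (L ^ (c / η)) ^ 2 / (L ^ (c / η) + 1) ≤ L ^ (c / η) := by
    rw [div_le_iff₀ (by positivity)]
    nlinarith
  have hlam : (L ^ (c / η)) ^ 2 / (L ^ (c / η) + 1) * (c * Real.logb 2 L) ≤
      c / Real.log 2 * L ^ (c / η + 1) := by
    calc _ ≤ L ^ (c / η) * (c * (L / Real.log 2)) := by gcongr
      _ = _ := by rw [Real.rpow_add_one hL0.ne']; ring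
  have hexp : (c / η + 1) * ε ≤ 1 := by
    rw [le_div_iff₀ (by positivity)] at hε
    rw [div_add_one hη0.ne', div_mul_eq_mul_div, div_le_one hη0]
    linarith
  calc _ ≤ (c / Real.log 2 * L ^ (c / η + 1)) ^ ε := by gcongr
    _ = (c / Real.log 2) ^ ε * L ^ ((c / η + 1) * ε) := by
      rw [Real.mul_rpow hK.le (by positivity), ← Real.rpow_mul hL0.le]
    _ ≤ (c / Real.log 2) ^ ε * L := by
      gcongr
      simpa using Real.rpow_le_rpow_of_exponent_le hL.le hexp
end
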